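/- Conservation of energy for second-order Lagrangians with no second-order time derivatives: let L be a second-order Lagrangian density with L_{q_{00}} ≡ 0, let V ⊂ ℝ³ be a compact rectangular box, and let φ : ℝ⁴ → ℝ be a smooth solution of the Euler–Lagrange equations E[φ] = 0 on ℝ × V. Then (i) pointwise (d/dε)|_{ε=0} L[φ + ε ∂₀φ](x) = ∂₀( L[φ] )(x); and (ii) if for every time t the boundary condition ∮_{∂V} [ (δS/δφ_i) ∂₀φ + ∂_j( L_{q_{ij}} ∂₀φ ) ] n_i dσ = 0 holds, where δS/δφ_μ := L_{p_μ} − ∂_ν(L_{q_{μν}} + L_{q_{νμ}}), then the energy E(t) := ∫_V [ (δS/δφ₀) ∂₀φ − L[φ] ](t,·) d³x + ∮_{∂V} (L_{q_{0i}} + L_{q_{i0}}) ∂₀φ n_i dσ is constant in t. -/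

import Mathlib

noncomputable section

/-- Partial derivative of `f : ℝ⁴ → ℝ` in the `μ`-th coordinate direction. -/
def pd (μ : Fin 4) (f : (Fin 4 → ℝ) → ℝ) (x : Fin 4 → ℝ) : ℝ :=
  fderiv ℝ f x (Pi.single μ 1)

/-- A second-order Lagrangian density: a function of `u ∈ ℝ`, `p ∈ ℝ⁴`, `q ∈ ℝ^{4×4}`. -/
abbrev Lagrangian := ℝ → (Fin 4 → ℝ) → (Fin 4 → Fin 4 → ℝ) → ℝ

/-- Smoothness of a Lagrangian density in all its arguments. -/
def SmoothLagrangian (L : Lagrangian) : Prop :=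
  ContDiff ℝ (⊤ : ℕ∞) (fun z : ℝ × (Fin 4 → ℝ) × (Fin 4 → Fin 4 → ℝ) => L z.1 z.2.1 z.2.2)

/-- First derivatives `∂_μ φ` of a field. -/
def jet1 (φ : (Fin 4 → ℝ) → ℝ) (x : Fin 4 → ℝ) : Fin 4 → ℝ := fun μ => pd μ φ x

/-- Second derivatives `∂_μ ∂_ν φ` of a field. -/
def jet2 (φ : (Fin 4 → ℝ) → ℝ) (x : Fin 4 → ℝ) : Fin 4 → Fin 4 → ℝ :=
  fun μ ν => pd μ (pd ν φ) x

/-- The value `L[φ](x)` of the Lagrangian on the 2-jet of `φ`. -/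
def onJet (L : Lagrangian) (φ : (Fin 4 → ℝ) → ℝ) (x : Fin 4 → ℝ) : ℝ :=
  L (φ x) (jet1 φ x) (jet2 φ x)

/-- Partial derivative `L_u` of the Lagrangian with respect to its first argument. -/
def Lu (L : Lagrangian) (u : ℝ) (p : Fin 4 → ℝ) (q : Fin 4 → Fin 4 → ℝ) : ℝ :=
  deriv (fun v => L v p q) u

/-- Partial derivative `L_{p_μ}`. -/
def Lp (L : Lagrangian) (μ : Fin 4) (u : ℝ) (p : Fin 4 → ℝ) (q : Fin 4 → Fin 4 → ℝ) : ℝ :=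
  fderiv ℝ (fun p' => L u p' q) p (Pi.single μ 1)

/-- Partial derivative `L_{q_{μν}}`. -/
def Lq (L : Lagrangian) (μ ν : Fin 4) (u : ℝ) (p : Fin 4 → ℝ) (q : Fin 4 → Fin 4 → ℝ) : ℝ :=
  fderiv ℝ (fun q' => L u p q') q (Pi.single μ (Pi.single ν 1))

/-- `L_u` evaluated on the 2-jet of `φ`. -/
def LuJ (L : Lagrangian) (φ : (Fin 4 → ℝ) → ℝ) (x : Fin 4 → ℝ) : ℝ :=
  Lu L (φ x) (jet1 φ x) (jet2 φ x)

/-- `L_{p_μ}` evaluated on the 2-jet of `φ`. -/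
def LpJ (L : Lagrangian) (μ : Fin 4) (φ : (Fin 4 → ℝ) → ℝ) (x : Fin 4 → ℝ) : ℝ :=
  Lp L μ (φ x) (jet1 φ x) (jet2 φ x)

/-- `L_{q_{μν}}` evaluated on the 2-jet of `φ`. -/
def LqJ (L : Lagrangian) (μ ν : Fin 4) (φ : (Fin 4 → ℝ) → ℝ) (x : Fin 4 → ℝ) : ℝ :=
  Lq L μ ν (φ x) (jet1 φ x) (jet2 φ x)

/-- The Euler–Lagrange expression
`E[φ] = L_u − ∂_μ(L_{p_μ}) + ∂_ν ∂_μ (L_{q_{μν}})`. -/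
def EulerLagrange (L : Lagrangian) (φ : (Fin 4 → ℝ) → ℝ) (x : Fin 4 → ℝ) : ℝ :=
  LuJ L φ x - (∑ μ, pd μ (LpJ L μ φ) x)
    + ∑ μ, ∑ ν, pd ν (pd μ (LqJ L μ ν φ)) x

/-- The first variation `(d/dε)|₀ L[φ + εψ](x)`. -/
def firstVariation (L : Lagrangian) (φ ψ : (Fin 4 → ℝ) → ℝ) (x : Fin 4 → ℝ) : ℝ :=
  deriv (fun ε : ℝ => onJet L (fun y => φ y + ε * ψ y) x) 0

/-- The boundary current
`Θ^μ = (L_{p_μ} − ∂_ν L_{q_{νμ}}) ψ + L_{q_{μν}} ∂_ν ψ`. -/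
def Theta (L : Lagrangian) (φ ψ : (Fin 4 → ℝ) → ℝ) (μ : Fin 4) (x : Fin 4 → ℝ) : ℝ :=
  (LpJ L μ φ x - ∑ ν, pd ν (LqJ L ν μ φ) x) * ψ x
    + ∑ ν, LqJ L μ ν φ x * pd ν ψ x

open MeasureTheory

/-- Integral over the face `{y ∈ [a,b] : y i = c}` of the box `[a,b] ⊂ ℝ³`,
parametrised by the remaining two coordinates. -/
def faceIntegral (a b : Fin 3 → ℝ) (i : Fin 3) (c : ℝ) (f : (Fin 3 → ℝ) → ℝ) : ℝ :=
  ∫ z in Set.Icc (i.removeNth a) (i.removeNth b), f (i.insertNth c z)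

/-- Outward flux of the spatial vector field `G` through the boundary of the box
`[a,b] ⊂ ℝ³`: the sum over `i = 1,2,3` of the integral of `G i` over the face
`y i = b i` minus the integral of `G i` over the face `y i = a i`. -/
def boundaryFlux (a b : Fin 3 → ℝ) (G : Fin 3 → (Fin 3 → ℝ) → ℝ) : ℝ :=
  ∑ i, (faceIntegral a b i (b i) (G i) - faceIntegral a b i (a i) (G i))

/-- The functional derivative `δS/δφ_μ = L_{p_μ} − ∂_ν (L_{q_{μν}} + L_{q_{νμ}})`,
evaluated on the 2-jet of `φ`. -/
def dSdphi (L : Lagrangian) (μ : Fin 4) (φ : (Fin 4 → ℝ) → ℝ) (x : Fin 4 → ℝ) : ℝ :=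
  LpJ L μ φ x - ∑ ν, pd ν (fun y => LqJ L μ ν φ y + LqJ L ν μ φ y) x

/-- The energy
`E(t) = ∫_V [(δS/δφ₀) ∂₀φ − L[φ]](t,·) d³x + ∮_{∂V} (L_{q_{0i}} + L_{q_{i0}}) ∂₀φ n_i dσ`. -/
def energy (L : Lagrangian) (a b : Fin 3 → ℝ) (φ : (Fin 4 → ℝ) → ℝ) (t : ℝ) : ℝ :=
  (∫ y in Set.Icc a b,
      (dSdphi L 0 φ (Fin.cons t y) * pd 0 φ (Fin.cons t y) - onJet L φ (Fin.cons t y)))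
    + boundaryFlux a b (fun i y =>
        (LqJ L 0 i.succ φ (Fin.cons t y) + LqJ L i.succ 0 φ (Fin.cons t y))
          * pd 0 φ (Fin.cons t y))

/-- Smoothness of a scalar function on `ℝ⁴`. -/
abbrev SmoothField (f : (Fin 4 → ℝ) → ℝ) : Prop := ContDiff ℝ (⊤ : ℕ∞) f

section PartialDerivatives

variable {f g : (Fin 4 → ℝ) → ℝ}

theorem SmoothField.differentiableAt (hf : SmoothField f) (x : Fin 4 → ℝ) :
    DifferentiableAt ℝ f x :=
  hf.contDiffAt.differentiableAt (by simp)

theorem SmoothField.fderiv_apply_const (hf : SmoothField f) (v : Fin 4 → ℝ) :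
    SmoothField (fun x => fderiv ℝ f x v) :=
  (hf.fderiv_right (by simp)).clm_apply contDiff_const

theorem SmoothField.pd (hf : SmoothField f) (μ : Fin 4) : SmoothField (pd μ f) :=
  hf.fderiv_apply_const _

theorem pd_add (hf : SmoothField f) (hg : SmoothField g) (μ : Fin 4) (x : Fin 4 → ℝ) :
    pd μ (fun y => f y + g y) x = pd μ f x + pd μ g x := by
  simp only [pd]
  rw [fderiv_fun_add (hf.differentiableAt x) (hg.differentiableAt x)]
  rfl

theorem pd_sub (hf : SmoothField f) (hg : SmoothField g) (μ : Fin 4) (x : Fin 4 → ℝ) :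
    pd μ (fun y => f y - g y) x = pd μ f x - pd μ g x := by
  simp only [pd]
  rw [fderiv_fun_sub (hf.differentiableAt x) (hg.differentiableAt x)]
  rfl

theorem pd_mul (hf : SmoothField f) (hg : SmoothField g) (μ : Fin 4) (x : Fin 4 → ℝ) :
    pd μ (fun y => f y * g y) x = pd μ f x * g x + f x * pd μ g x := by
  simp only [pd]
  rw [fderiv_fun_mul (hf.differentiableAt x) (hg.differentiableAt x)]
  simp
  ring

theorem pd_sum {ι : Type*} {s : Finset ι} {F : ι → (Fin 4 → ℝ) → ℝ}
    (hF : ∀ i, SmoothField (F i)) (μ : Fin 4) (x : Fin 4 → ℝ) :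
    pd μ (fun y => ∑ i ∈ s, F i y) x = ∑ i ∈ s, pd μ (F i) x := by
  simp only [pd]
  rw [fderiv_fun_sum fun i _ => (hF i).differentiableAt x]
  simp

theorem pd_comm (hf : SmoothField f) (μ ν : Fin 4) (x : Fin 4 → ℝ) :
    pd μ (pd ν f) x = pd ν (pd μ f) x := by
  have hd : DifferentiableAt ℝ (fderiv ℝ f) x :=
    ((hf.fderiv_right (m := (⊤ : ℕ∞)) (by simp)).contDiffAt).differentiableAt (by simp)
  have key : ∀ α β : Fin 4, pd α (pd β f) x =
      fderiv ℝ (fderiv ℝ f) x (Pi.single α 1) (Pi.single β 1) := fun α β => by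
    change fderiv ℝ (fun y => fderiv ℝ f y (Pi.single β 1)) x (Pi.single α 1) = _
    rw [fderiv_clm_apply hd (differentiableAt_const _)]
    simp
  rw [key, key]
  exact (hf.contDiffAt.isSymmSndFDerivAt (by
    rw [minSmoothness_of_isRCLikeNormedField]
    exact WithTop.coe_le_coe.2 (le_top : (2 : ℕ∞) ≤ ⊤))).eq _ _

end PartialDerivatives

section Jets

/-- A Lagrangian as a function on the product of its argument spaces. -/
def Lagrangian.onProd (L : Lagrangian) (z : ℝ × (Fin 4 → ℝ) × (Fin 4 → Fin 4 → ℝ)) : ℝ :=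
  L z.1 z.2.1 z.2.2

/-- The 2-jet of a field. -/
def jet (φ : (Fin 4 → ℝ) → ℝ) (x : Fin 4 → ℝ) : ℝ × (Fin 4 → ℝ) × (Fin 4 → Fin 4 → ℝ) :=
  (φ x, jet1 φ x, jet2 φ x)

variable {L : Lagrangian} {φ ψ : (Fin 4 → ℝ) → ℝ}

theorem SmoothLagrangian.hasFDerivAt (hL : SmoothLagrangian L)
    (z : ℝ × (Fin 4 → ℝ) × (Fin 4 → Fin 4 → ℝ)) :
    HasFDerivAt L.onProd (fderiv ℝ L.onProd z) z :=
  (ContDiff.contDiffAt hL |>.differentiableAt (by simp)).hasFDerivAt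

theorem SmoothLagrangian.Lu_eq (hL : SmoothLagrangian L) (u : ℝ) (p : Fin 4 → ℝ)
    (q : Fin 4 → Fin 4 → ℝ) : Lu L u p q = fderiv ℝ L.onProd (u, p, q) (1, 0, 0) := by
  have h := (hL.hasFDerivAt (u, p, q)).comp_hasDerivAt u
    ((hasDerivAt_id u).prodMk (hasDerivAt_const u (p, q)))
  exact h.deriv

theorem SmoothLagrangian.Lp_eq (hL : SmoothLagrangian L) (μ : Fin 4) (u : ℝ) (p : Fin 4 → ℝ)
    (q : Fin 4 → Fin 4 → ℝ) :
    Lp L μ u p q = fderiv ℝ L.onProd (u, p, q) (0, Pi.single μ 1, 0) := by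
  have h := HasFDerivAt.comp (f := fun p' => (u, p', q)) p (hL.hasFDerivAt (u, p, q))
    ((hasFDerivAt_const u p).prodMk ((hasFDerivAt_id p).prodMk (hasFDerivAt_const q p)))
  exact congrArg (fun T => T (Pi.single μ 1)) h.fderiv

theorem SmoothLagrangian.Lq_eq (hL : SmoothLagrangian L) (μ ν : Fin 4) (u : ℝ) (p : Fin 4 → ℝ)
    (q : Fin 4 → Fin 4 → ℝ) :
    Lq L μ ν u p q = fderiv ℝ L.onProd (u, p, q) (0, 0, Pi.single μ (Pi.single ν 1)) := by
  have h := HasFDerivAt.comp (f := fun q' => (u, p, q')) q (hL.hasFDerivAt (u, p, q))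
    ((hasFDerivAt_const u q).prodMk ((hasFDerivAt_const p q).prodMk (hasFDerivAt_id q)))
  exact congrArg (fun T => T (Pi.single μ (Pi.single ν 1))) h.fderiv

theorem contDiff_jet (hφ : SmoothField φ) : ContDiff ℝ (⊤ : ℕ∞) (jet φ) :=
  hφ.prodMk ((contDiff_pi.2 fun μ => hφ.pd μ).prodMk
    (contDiff_pi.2 fun μ => contDiff_pi.2 fun ν => (hφ.pd ν).pd μ))

theorem SmoothLagrangian.smooth_fderiv_jet (hL : SmoothLagrangian L) (hφ : SmoothField φ)
    (v : ℝ × (Fin 4 → ℝ) × (Fin 4 → Fin 4 → ℝ)) :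
    SmoothField (fun x => fderiv ℝ L.onProd (jet φ x) v) :=
  ((ContDiff.fderiv_right (m := (⊤ : ℕ∞)) (f := L.onProd) hL (by simp)).comp
    (contDiff_jet hφ)).clm_apply contDiff_const

theorem smooth_onJet (hL : SmoothLagrangian L) (hφ : SmoothField φ) : SmoothField (onJet L φ) :=
  ContDiff.comp (g := L.onProd) hL (contDiff_jet hφ)

theorem smooth_LpJ (hL : SmoothLagrangian L) (hφ : SmoothField φ) (μ : Fin 4) :
    SmoothField (LpJ L μ φ) :=
  (funext fun _ => hL.Lp_eq _ _ _ _ :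
    LpJ L μ φ = fun x => fderiv ℝ L.onProd (jet φ x) (0, Pi.single μ 1, 0)) ▸
      hL.smooth_fderiv_jet hφ _

theorem smooth_LqJ (hL : SmoothLagrangian L) (hφ : SmoothField φ) (μ ν : Fin 4) :
    SmoothField (LqJ L μ ν φ) :=
  (funext fun _ => hL.Lq_eq _ _ _ _ _ :
    LqJ L μ ν φ = fun x => fderiv ℝ L.onProd (jet φ x) (0, 0, Pi.single μ (Pi.single ν 1))) ▸
      hL.smooth_fderiv_jet hφ _

theorem smooth_dSdphi (hL : SmoothLagrangian L) (hφ : SmoothField φ) (μ : Fin 4) :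
    SmoothField (dSdphi L μ φ) :=
  (smooth_LpJ hL hφ μ).sub (ContDiff.sum fun ν _ =>
    SmoothField.pd ((smooth_LqJ hL hφ μ ν).add (smooth_LqJ hL hφ ν μ)) ν)

theorem jet_add_smul (hφ : SmoothField φ) (hψ : SmoothField ψ) (ε : ℝ) (x : Fin 4 → ℝ) :
    jet (fun y => φ y + ε * ψ y) x = jet φ x + ε • jet ψ x := by
  have h1 : ∀ {f g : (Fin 4 → ℝ) → ℝ}, SmoothField f → SmoothField g → ∀ μ,
      pd μ (fun y => f y + ε * g y) = fun y => pd μ f y + ε * pd μ g y := by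
    intro f g hf hg μ
    funext y
    rw [pd_add hf (contDiff_const.mul hg), pd_mul contDiff_const hg]
    simp [pd]
  refine Prod.ext rfl (Prod.ext (funext fun μ => ?_) (funext fun μ => funext fun ν => ?_))
  · exact congrFun (h1 hφ hψ μ) x
  · change pd μ (pd ν _) x = _
    rw [h1 hφ hψ, h1 (hφ.pd ν) (hψ.pd ν)]
    rfl

theorem firstVariation_eq_fderiv (hL : SmoothLagrangian L) (hφ : SmoothField φ)
    (hψ : SmoothField ψ) (x : Fin 4 → ℝ) :
    firstVariation L φ ψ x = fderiv ℝ L.onProd (jet φ x) (jet ψ x) := by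
  have hline : HasDerivAt (fun ε : ℝ => jet φ x + ε • jet ψ x) (jet ψ x) 0 := by
    simpa using ((hasDerivAt_id (0 : ℝ)).smul_const (jet ψ x)).const_add (jet φ x)
  have h := HasFDerivAt.comp_hasDerivAt_of_eq (0 : ℝ) (hL.hasFDerivAt (jet φ x)) hline (by simp)
  rw [← h.deriv]
  exact congrArg (fun F => deriv F 0)
    (funext fun ε => congrArg L.onProd (jet_add_smul hφ hψ ε x))

theorem fderiv_jet_apply (hφ : SmoothField φ) (μ : Fin 4) (x : Fin 4 → ℝ) :
    fderiv ℝ (jet φ) x (Pi.single μ 1) = jet (pd μ φ) x := by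
  have h : HasFDerivAt (jet φ) ((fderiv ℝ φ x).prod
      ((ContinuousLinearMap.pi fun α => fderiv ℝ (pd α φ) x).prod
        (ContinuousLinearMap.pi fun α => ContinuousLinearMap.pi fun β =>
          fderiv ℝ (pd α (pd β φ)) x))) x :=
    (hφ.differentiableAt x).hasFDerivAt.prodMk
      ((hasFDerivAt_pi.2 fun α => ((hφ.pd α).differentiableAt x).hasFDerivAt).prodMk
        (hasFDerivAt_pi.2 fun α => hasFDerivAt_pi.2 fun β =>
          (((hφ.pd β).pd α).differentiableAt x).hasFDerivAt))
  rw [h.fderiv]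
  refine Prod.ext rfl (Prod.ext (funext fun α => ?_) (funext fun α => funext fun β => ?_))
  · exact pd_comm hφ μ α x
  · change pd μ (pd α (pd β φ)) x = pd α (pd β (pd μ φ)) x
    rw [pd_comm (hφ.pd β), show pd μ (pd β φ) = pd β (pd μ φ) from funext (pd_comm hφ μ β)]

/-- Translation in a coordinate direction: the variation along `∂_μ φ` is `∂_μ (L[φ])`. -/
theorem firstVariation_pd (hL : SmoothLagrangian L) (hφ : SmoothField φ) (μ : Fin 4)
    (x : Fin 4 → ℝ) : firstVariation L φ (pd μ φ) x = pd μ (onJet L φ) x := by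
  rw [firstVariation_eq_fderiv hL hφ (hφ.pd μ), ← fderiv_jet_apply hφ]
  have h := (hL.hasFDerivAt (jet φ x)).comp x
    ((contDiff_jet hφ).contDiffAt.differentiableAt (by simp)).hasFDerivAt
  exact (congrArg (fun T => T (Pi.single μ 1)) h.fderiv).symm

theorem firstVariation_eq_sum (hL : SmoothLagrangian L) (hφ : SmoothField φ)
    (hψ : SmoothField ψ) (x : Fin 4 → ℝ) :
    firstVariation L φ ψ x = LuJ L φ x * ψ x + (∑ μ, LpJ L μ φ x * pd μ ψ x)
      + ∑ μ, ∑ ν, LqJ L μ ν φ x * pd μ (pd ν ψ) x := by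
  have hdecomp : jet ψ x = ψ x • ((1 : ℝ), (0 : Fin 4 → ℝ), (0 : Fin 4 → Fin 4 → ℝ))
      + (∑ μ, pd μ ψ x • ((0 : ℝ), (Pi.single μ 1 : Fin 4 → ℝ), (0 : Fin 4 → Fin 4 → ℝ)))
      + ∑ μ, ∑ ν, pd μ (pd ν ψ) x •
          ((0 : ℝ), (0 : Fin 4 → ℝ), (Pi.single μ (Pi.single ν 1) : Fin 4 → Fin 4 → ℝ)) := by
    refine Prod.ext ?_ (Prod.ext (funext fun α => ?_) (funext fun α => funext fun β => ?_))
    · simp [jet, Prod.fst_sum]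
    · simp [jet, jet1, Prod.fst_sum, Prod.snd_sum, Pi.single_apply]
    · have h : ∀ μ ν : Fin 4, (Pi.single μ (Pi.single ν 1) : Fin 4 → Fin 4 → ℝ) α β
          = if α = μ then (if β = ν then 1 else 0) else 0 := fun μ ν => by
        by_cases hα : α = μ
        · subst hα; simp [Pi.single_apply]
        · simp [hα]
      simp [jet, jet2, Prod.snd_sum, h]
  rw [firstVariation_eq_fderiv hL hφ hψ, hdecomp]
  simp only [map_add, map_sum, map_smul, smul_eq_mul, LuJ, LpJ, LqJ, hL.Lu_eq, hL.Lp_eq, hL.Lq_eq]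
  simp only [mul_comm]
  rfl

/-- The first variation formula: `δL = E[φ] ψ + ∂_μ ((δS/δφ_μ) ψ + ∂_ν (L_{q_{μν}} ψ))`. -/
theorem firstVariation_eq_divergence (hL : SmoothLagrangian L) (hφ : SmoothField φ)
    (hψ : SmoothField ψ) (x : Fin 4 → ℝ) :
    firstVariation L φ ψ x = EulerLagrange L φ x * ψ x
      + ((∑ μ, pd μ (fun y => dSdphi L μ φ y * ψ y) x)
        + ∑ μ, ∑ ν, pd μ (pd ν (fun y => LqJ L μ ν φ y * ψ y)) x) := by
  have hQ := smooth_LqJ hL hφ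
  have hS : ∀ μ, pd μ (fun y => dSdphi L μ φ y * ψ y) x =
      (pd μ (LpJ L μ φ) x - ∑ ν, (pd μ (pd ν (LqJ L μ ν φ)) x + pd μ (pd ν (LqJ L ν μ φ)) x))
        * ψ x
      + (LpJ L μ φ x - ∑ ν, (pd ν (LqJ L μ ν φ) x + pd ν (LqJ L ν μ φ) x)) * pd μ ψ x := by
    intro μ
    have e : dSdphi L μ φ = fun y =>
        LpJ L μ φ y - ∑ ν, (pd ν (LqJ L μ ν φ) y + pd ν (LqJ L ν μ φ) y) :=
      funext fun y => congrArg (LpJ L μ φ y - ·)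
        (Finset.sum_congr rfl fun ν _ => pd_add (hQ μ ν) (hQ ν μ) ν y)
    have hs : ∀ ν, SmoothField (fun y => pd ν (LqJ L μ ν φ) y + pd ν (LqJ L ν μ φ) y) :=
      fun ν => ((hQ μ ν).pd ν).add ((hQ ν μ).pd ν)
    rw [pd_mul (smooth_dSdphi hL hφ μ) hψ, e,
      pd_sub (smooth_LpJ hL hφ μ) (ContDiff.sum fun ν _ => hs ν), pd_sum hs]
    simp only [pd_add ((hQ μ _).pd _) ((hQ _ μ).pd _)]
  have hR : ∀ μ ν, pd μ (pd ν (fun y => LqJ L μ ν φ y * ψ y)) x =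
      (pd μ (pd ν (LqJ L μ ν φ)) x * ψ x + pd ν (LqJ L μ ν φ) x * pd μ ψ x)
        + (pd μ (LqJ L μ ν φ) x * pd ν ψ x + LqJ L μ ν φ x * pd μ (pd ν ψ) x) := by
    intro μ ν
    rw [show pd ν (fun y => LqJ L μ ν φ y * ψ y) = fun y =>
        pd ν (LqJ L μ ν φ) y * ψ y + LqJ L μ ν φ y * pd ν ψ y from
      funext (pd_mul (hQ μ ν) hψ ν),
      pd_add (((hQ μ ν).pd ν).mul hψ) ((hQ μ ν).mul (hψ.pd ν)),
      pd_mul ((hQ μ ν).pd ν) hψ, pd_mul (hQ μ ν) (hψ.pd ν)]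
  rw [firstVariation_eq_sum hL hφ hψ]
  simp only [hS, hR, EulerLagrange, Fin.sum_univ_four]
  ring

end Jets

section BoxIntegrals

theorem continuous_cons_time {n : ℕ} (t : ℝ) :
    Continuous (fun y : Fin n → ℝ => (Fin.cons t y : Fin (n + 1) → ℝ)) :=
  Continuous.finCons continuous_const continuous_id

/-- Differentiation in time under the integral over a compact box. -/
theorem hasDerivAt_integral_cons {n : ℕ} {f : (Fin 4 → ℝ) → ℝ} (hf : SmoothField f)
    {g : (Fin n → ℝ) → Fin 3 → ℝ} (hg : Continuous g) (a b : Fin n → ℝ) (t : ℝ) :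
    HasDerivAt (fun s : ℝ => ∫ z in Set.Icc a b, f (Fin.cons s (g z)))
      (∫ z in Set.Icc a b, pd 0 f (Fin.cons t (g z))) t := by
  have hc : Continuous (fun w : ℝ × (Fin n → ℝ) => (Fin.cons w.1 (g w.2) : Fin 4 → ℝ)) :=
    Continuous.finCons continuous_fst (hg.comp continuous_snd)
  have hslice : ∀ s : ℝ, Continuous (fun z => (Fin.cons s (g z) : Fin 4 → ℝ)) := fun s =>
    hc.comp (Continuous.prodMk_right s)
  obtain ⟨C, hC⟩ := ((isCompact_Icc (a := t - 1) (b := t + 1)).prod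
    (isCompact_Icc (a := a) (b := b))).exists_bound_of_continuousOn
      ((hf.pd 0).continuous.comp hc).continuousOn
  refine (hasDerivAt_integral_of_dominated_loc_of_deriv_le (bound := fun _ => C)
    (F := fun s z => f (Fin.cons s (g z))) (F' := fun s z => pd 0 f (Fin.cons s (g z)))
    (Icc_mem_nhds (by linarith : t - 1 < t) (by linarith : t < t + 1)) ?_ ?_ ?_ ?_ ?_ ?_).2
  · exact Filter.Eventually.of_forall fun s =>
      (hf.continuous.comp (hslice s)).aestronglyMeasurable
  · exact (hf.continuous.comp (hslice t)).continuousOn.integrableOn_compact isCompact_Icc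
  · exact ((hf.pd 0).continuous.comp (hslice t)).aestronglyMeasurable
  · exact (ae_restrict_iff' measurableSet_Icc).2
      (Filter.Eventually.of_forall fun z hz s hs => hC (s, z) ⟨hs, hz⟩)
  · exact continuousOn_const.integrableOn_compact isCompact_Icc
  · refine Filter.Eventually.of_forall fun z s _ => ?_
    have hline : HasDerivAt (fun r : ℝ => (Fin.cons r (g z) : Fin 4 → ℝ)) (Pi.single 0 1) s := by
      rw [hasDerivAt_pi]
      intro i
      refine Fin.cases ?_ (fun j => ?_) i
      · simpa using hasDerivAt_id' s
      · simpa using hasDerivAt_const s (g z j)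
    exact HasFDerivAt.comp_hasDerivAt (l := f) s (hf.differentiableAt _).hasFDerivAt hline

theorem continuous_insertNth_const {n : ℕ} (i : Fin (n + 1)) (c : ℝ) :
    Continuous (fun z : Fin n → ℝ => (i.insertNth c z : Fin (n + 1) → ℝ)) :=
  Continuous.finInsertNth i continuous_const continuous_id

theorem boundaryFlux_add {a b : Fin 3 → ℝ} {G H : Fin 3 → (Fin 3 → ℝ) → ℝ}
    (hG : ∀ i, Continuous (G i)) (hH : ∀ i, Continuous (H i)) :
    boundaryFlux a b (fun i y => G i y + H i y) = boundaryFlux a b G + boundaryFlux a b H := by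
  have h : ∀ i c, faceIntegral a b i c (fun y => G i y + H i y)
      = faceIntegral a b i c (G i) + faceIntegral a b i c (H i) := fun i c =>
    integral_add
      (((hG i).comp (continuous_insertNth_const i c)).continuousOn.integrableOn_compact
        isCompact_Icc)
      (((hH i).comp (continuous_insertNth_const i c)).continuousOn.integrableOn_compact
        isCompact_Icc)
  simp only [boundaryFlux, h, ← Finset.sum_add_distrib]
  exact Finset.sum_congr rfl fun i _ => by ring

theorem hasDerivAt_boundaryFlux {a b : Fin 3 → ℝ} {G : Fin 3 → (Fin 4 → ℝ) → ℝ}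
    (hG : ∀ i, SmoothField (G i)) (t : ℝ) :
    HasDerivAt (fun s : ℝ => boundaryFlux a b (fun i y => G i (Fin.cons s y)))
      (boundaryFlux a b (fun i y => pd 0 (G i) (Fin.cons t y))) t :=
  HasDerivAt.fun_sum fun i _ =>
    (hasDerivAt_integral_cons (hG i) (continuous_insertNth_const i (b i)) _ _ t).sub
      (hasDerivAt_integral_cons (hG i) (continuous_insertNth_const i (a i)) _ _ t)

/-- The divergence theorem on a box in a time slice of `ℝ⁴`. -/
theorem integral_divergence_eq_boundaryFlux {a b : Fin 3 → ℝ} (hab : a ≤ b)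
    {G : Fin 3 → (Fin 4 → ℝ) → ℝ} (hG : ∀ i, SmoothField (G i)) (t : ℝ) :
    ∫ y in Set.Icc a b, ∑ i, pd i.succ (G i) (Fin.cons t y)
      = boundaryFlux a b (fun i y => G i (Fin.cons t y)) := by
  let ι : (Fin 3 → ℝ) →L[ℝ] (Fin 4 → ℝ) :=
    ContinuousLinearMap.pi (Fin.cons 0 fun j => ContinuousLinearMap.proj j)
  have hι : ∀ y, HasFDerivAt (fun y : Fin 3 → ℝ => (Fin.cons t y : Fin 4 → ℝ)) ι y := by
    intro y
    rw [hasFDerivAt_pi']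
    intro i
    refine Fin.cases ?_ (fun j => ?_) i
    · exact hasFDerivAt_const t y
    · exact hasFDerivAt_apply j y
  have hιe : ∀ i, ι (Pi.single i 1) = Pi.single i.succ 1 := by
    intro i
    funext k
    refine Fin.cases ?_ (fun j => ?_) k
    · simp [ι]
    · simp [ι, Pi.single_apply]
  have h := integral_divergence_of_hasFDerivAt_off_countable' a b hab
    (fun i y => G i (Fin.cons t y)) (fun i y => (fderiv ℝ (G i) (Fin.cons t y)).comp ι) ∅
    Set.countable_empty
    (fun i => ((hG i).continuous.comp (continuous_cons_time t)).continuousOn)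
    (fun y _ i => ((hG i).differentiableAt _).hasFDerivAt.comp y (hι y)) ?_
  · simp only [ContinuousLinearMap.comp_apply, hιe] at h
    exact h
  · simp only [ContinuousLinearMap.comp_apply, hιe]
    exact (continuous_finsetSum _ fun i _ =>
      ((hG i).pd i.succ).continuous.comp
        (continuous_cons_time t)).continuousOn.integrableOn_compact isCompact_Icc

end BoxIntegrals

section Energy

/-- The spatial energy current
`(δS/δφ_i) ∂₀φ + ∂_j (L_{q_{ij}} ∂₀φ)` entering the boundary condition. -/
def energyCurrent (L : Lagrangian) (φ : (Fin 4 → ℝ) → ℝ) (i : Fin 3) (x : Fin 4 → ℝ) : ℝ :=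
  dSdphi L i.succ φ x * pd 0 φ x
    + ∑ j : Fin 3, pd j.succ (fun x => LqJ L i.succ j.succ φ x * pd 0 φ x) x

/-- The boundary energy density `(L_{q_{0i}} + L_{q_{i0}}) ∂₀φ`. -/
def boundaryEnergy (L : Lagrangian) (φ : (Fin 4 → ℝ) → ℝ) (i : Fin 3) (x : Fin 4 → ℝ) : ℝ :=
  (LqJ L 0 i.succ φ x + LqJ L i.succ 0 φ x) * pd 0 φ x

variable {L : Lagrangian} {φ : (Fin 4 → ℝ) → ℝ}

theorem smooth_energyCurrent (hL : SmoothLagrangian L) (hφ : SmoothField φ) (i : Fin 3) :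
    SmoothField (energyCurrent L φ i) :=
  ((smooth_dSdphi hL hφ _).mul (hφ.pd 0)).add (ContDiff.sum fun j _ =>
    SmoothField.pd ((smooth_LqJ hL hφ _ _).mul (hφ.pd 0)) j.succ)

theorem smooth_boundaryEnergy (hL : SmoothLagrangian L) (hφ : SmoothField φ) (i : Fin 3) :
    SmoothField (boundaryEnergy L φ i) :=
  ((smooth_LqJ hL hφ _ _).add (smooth_LqJ hL hφ _ _)).mul (hφ.pd 0)

/-- The local energy balance for solutions of the Euler–Lagrange equations. -/
theorem pd_energyDensity (hL : SmoothLagrangian L)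
    (hq00 : ∀ (u : ℝ) (p : Fin 4 → ℝ) (q : Fin 4 → Fin 4 → ℝ), Lq L 0 0 u p q = 0)
    (hφ : SmoothField φ) {x : Fin 4 → ℝ} (hx : EulerLagrange L φ x = 0) :
    pd 0 (fun y => dSdphi L 0 φ y * pd 0 φ y - onJet L φ y) x =
      -∑ i : Fin 3, pd i.succ
        (fun y => energyCurrent L φ i y + pd 0 (boundaryEnergy L φ i) y) x := by
  have hψ := hφ.pd 0
  have hR : ∀ μ ν, SmoothField (fun y => LqJ L μ ν φ y * pd 0 φ y) := fun μ ν =>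
    (smooth_LqJ hL hφ μ ν).mul hψ
  have hB : ∀ i : Fin 3, pd i.succ
      (fun y => energyCurrent L φ i y + pd 0 (boundaryEnergy L φ i) y) x =
      pd i.succ (fun y => dSdphi L i.succ φ y * pd 0 φ y) x
      + (∑ j : Fin 3, pd i.succ (pd j.succ (fun y => LqJ L i.succ j.succ φ y * pd 0 φ y)) x)
      + (pd 0 (pd i.succ (fun y => LqJ L 0 i.succ φ y * pd 0 φ y)) x
        + pd i.succ (pd 0 (fun y => LqJ L i.succ 0 φ y * pd 0 φ y)) x) := by
    intro i
    have e : boundaryEnergy L φ i = fun y =>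
        LqJ L 0 i.succ φ y * pd 0 φ y + LqJ L i.succ 0 φ y * pd 0 φ y :=
      funext fun y => add_mul _ _ _
    rw [pd_add (smooth_energyCurrent hL hφ i) ((smooth_boundaryEnergy hL hφ i).pd 0), e,
      show pd 0 (fun y => LqJ L 0 i.succ φ y * pd 0 φ y + LqJ L i.succ 0 φ y * pd 0 φ y)
        = fun y => pd 0 (fun y => LqJ L 0 i.succ φ y * pd 0 φ y) y
          + pd 0 (fun y => LqJ L i.succ 0 φ y * pd 0 φ y) y from
        funext (pd_add (hR _ _) (hR _ _) 0),
      pd_add ((hR _ _).pd 0) ((hR _ _).pd 0), pd_comm (hR 0 i.succ)]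
    congr 1
    unfold energyCurrent
    rw [pd_add ((smooth_dSdphi hL hφ _).mul hψ) (ContDiff.sum fun j _ => (hR _ _).pd _),
      pd_sum fun j => (hR _ _).pd _]
  have h00 : pd 0 (pd 0 (fun y => LqJ L 0 0 φ y * pd 0 φ y)) x = 0 := by
    have hz : ∀ μ, pd μ (fun _ => 0) = fun _ => 0 := fun μ => by
      funext y
      simp [pd]
    simp [LqJ, hq00, hz]
  have h := firstVariation_eq_divergence hL hφ hψ x
  rw [firstVariation_pd hL hφ, hx] at h
  rw [pd_sub ((smooth_dSdphi hL hφ 0).mul hψ) (smooth_onJet hL hφ), h]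
  simp only [hB, Fin.sum_univ_succ (n := 3), h00, Finset.sum_add_distrib]
  ring

/-- The energy is stationary when the boundary flux of the energy current vanishes. -/
theorem hasDerivAt_energy (hL : SmoothLagrangian L)
    (hq00 : ∀ (u : ℝ) (p : Fin 4 → ℝ) (q : Fin 4 → Fin 4 → ℝ), Lq L 0 0 u p q = 0)
    {a b : Fin 3 → ℝ} (hab : a ≤ b) (hφ : SmoothField φ) {t : ℝ}
    (hEL : ∀ y ∈ Set.Icc a b, EulerLagrange L φ (Fin.cons t y) = 0)
    (hflux : boundaryFlux a b (fun i y => energyCurrent L φ i (Fin.cons t y)) = 0) :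
    HasDerivAt (energy L a b φ) 0 t := by
  have hC := smooth_energyCurrent hL hφ
  have hB := smooth_boundaryEnergy hL hφ
  have h := (hasDerivAt_integral_cons
    (((smooth_dSdphi hL hφ 0).mul (hφ.pd 0)).sub (smooth_onJet hL hφ))
      continuous_id a b t).add (hasDerivAt_boundaryFlux (a := a) (b := b) hB t)
  refine h.congr_deriv ?_
  simp only [id]
  rw [setIntegral_congr_fun measurableSet_Icc
      fun y hy => pd_energyDensity hL hq00 hφ (hEL y hy),
    integral_neg, integral_divergence_eq_boundaryFlux hab fun i => (hC i).add ((hB i).pd 0),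
    boundaryFlux_add
      (G := fun i y => energyCurrent L φ i (Fin.cons t y))
      (H := fun i y => pd 0 (boundaryEnergy L φ i) (Fin.cons t y))
      (fun i => (hC i).continuous.comp (continuous_cons_time t))
      (fun i => ((hB i).pd 0).continuous.comp (continuous_cons_time t)),
    hflux]
  ring

end Energy

/-- **Conservation of energy for second-order Lagrangians with no second-order time
derivatives.**  Let `L` be a smooth second-order Lagrangian with `L_{q_{00}} ≡ 0`,
`V = [a,b] ⊂ ℝ³` a compact box and `φ` a smooth solution of the Euler–Lagrange
equations on `ℝ × V`.  Then (i) pointwise `(d/dε)|₀ L[φ + ε ∂₀φ](x) = ∂₀(L[φ])(x)`;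
and (ii) if for every time the boundary condition
`∮_{∂V} [(δS/δφ_i) ∂₀φ + ∂_j (L_{q_{ij}} ∂₀φ)] n_i dσ = 0` holds, then the energy
`E(t) = ∫_V [(δS/δφ₀) ∂₀φ − L[φ]] d³x + ∮_{∂V} (L_{q_{0i}} + L_{q_{i0}}) ∂₀φ n_i dσ`
is constant in `t`. -/
theorem energy_conservation
    (L : Lagrangian) (hL : SmoothLagrangian L)
    (hq00 : ∀ (u : ℝ) (p : Fin 4 → ℝ) (q : Fin 4 → Fin 4 → ℝ), Lq L 0 0 u p q = 0)
    (a b : Fin 3 → ℝ) (hab : a ≤ b)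
    (φ : (Fin 4 → ℝ) → ℝ) (hφ : ContDiff ℝ (⊤ : ℕ∞) φ)
    (hEL : ∀ t : ℝ, ∀ y ∈ Set.Icc a b, EulerLagrange L φ (Fin.cons t y) = 0) :
    (∀ x, firstVariation L φ (pd 0 φ) x = pd 0 (onJet L φ) x)
      ∧ ((∀ t : ℝ,
            boundaryFlux a b (fun i y =>
              dSdphi L i.succ φ (Fin.cons t y) * pd 0 φ (Fin.cons t y)
                + ∑ j : Fin 3,
                    pd j.succ (fun x => LqJ L i.succ j.succ φ x * pd 0 φ x)
                      (Fin.cons t y)) = 0)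
          → ∀ t s : ℝ, energy L a b φ t = energy L a b φ s) := by
  refine ⟨firstVariation_pd hL hφ 0, fun hflux t s => ?_⟩
  have h : ∀ r, HasDerivAt (energy L a b φ) 0 r := fun r =>
    hasDerivAt_energy hL hq00 hab hφ (hEL r) (hflux r)
  exact is_const_of_deriv_eq_zero (fun r => (h r).differentiableAt) (fun r => (h r).deriv) t s

end
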